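/- For every choice, for each i ∈ I, of a subset S_i of the four frame-condition/axiom pairs {(NEC_i, □_i⊤), (CONEC_i, ¬□_i⊤), (P_i, ¬□_i⊥), (COP_i, □_i⊥)}, the Hilbert system obtained by adding to the base logic, for each i ∈ I, the axioms corresponding to the pairs in S_i, together with all instances of the schema (P_G) ¬□_G⊥ for all finite nonempty G ⊆ I, is sound and strongly complete with respect to the class of all models that satisfy, for each i ∈ I, the frame conditions corresponding to the pairs in S_i and moreover satisfy ∅ ∉ N_G(w) for every world w and every finite nonempty G ⊆ I. -/

import Mathlib

attribute [local instance] Classical.propDecidable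

/-- Formulas of the multi-modal language 𝔏: atoms, ⊥, ¬, ∨, and □_G for
finite nonempty G ⊆ I. -/
inductive Form (I : Type) : Type
  | atom : ℕ → Form I
  | bot  : Form I
  | neg  : Form I → Form I
  | or   : Form I → Form I → Form I
  | box  : (G : Finset I) → G.Nonempty → Form I → Form I

namespace Form
variable {I : Type}
/-- φ ∧ ψ -/
def and (φ ψ : Form I) : Form I := .neg (.or (.neg φ) (.neg ψ))
/-- φ → ψ -/
def imp (φ ψ : Form I) : Form I := .or (.neg φ) ψ
/-- ⊤ -/
def top : Form I := .neg .bot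
/-- φ ↔ ψ -/
def iff (φ ψ : Form I) : Form I := (φ.imp ψ).and (ψ.imp φ)
end Form

/-- The pointwise-intersection neighbourhood function:
`N_G(w) = { ⋂_{i∈G} X_i : X_i ∈ N_i(w) }`. -/
def ptwInter {I W : Type} (N : I → W → Set (Set W)) (G : Finset I) (w : W) :
    Set (Set W) :=
  { X | ∃ Y : I → Set W, (∀ i ∈ G, Y i ∈ N i w) ∧ X = ⋂ i ∈ G, Y i }

/-- Satisfaction at a world, relative to neighbourhood functions `N` and a
valuation `V`. -/
def satN {I W : Type} (N : I → W → Set (Set W)) (V : ℕ → Set W) :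
    Form I → W → Prop
  | .atom n, w => w ∈ V n
  | .bot, _ => False
  | .neg φ, w => ¬ satN N V φ w
  | .or φ ψ, w => satN N V φ w ∨ satN N V ψ w
  | .box G _ φ, w => { v | satN N V φ v } ∈ ptwInter N G w

/-- A neighbourhood model. -/
structure NbhModel (I : Type) where
  W : Type
  ne : Nonempty W
  N : I → W → Set (Set W)
  V : ℕ → Set W

/-- Truth in a model. -/
def NbhModel.sat {I : Type} (M : NbhModel I) (w : M.W) (φ : Form I) : Prop :=
  satN M.N M.V φ w

/-- Propositional evaluation treating atoms and boxed formulas as atomic. -/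
def evalP {I : Type} (v : Form I → Prop) : Form I → Prop
  | .atom n => v (.atom n)
  | .bot => False
  | .neg φ => ¬ evalP v φ
  | .or φ ψ => evalP v φ ∨ evalP v ψ
  | .box G h φ => v (.box G h φ)

/-- Classical propositional tautologies (in the extended modal language). -/
def Tautology {I : Type} (φ : Form I) : Prop := ∀ v, evalP v φ

theorem unionNE {I : Type} [DecidableEq I] {G H : Finset I}
    (hG : G.Nonempty) : (G ∪ H).Nonempty :=
  hG.mono Finset.subset_union_left

/-- Axiom schema B1: `(□_Gφ ∧ □_Hψ) → □_{G∪H}(φ∧ψ)` for disjoint G, H. -/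
def B1Ax (I : Type) [DecidableEq I] : Set (Form I) :=
  { χ | ∃ (G H : Finset I) (hG : G.Nonempty) (hH : H.Nonempty) (φ ψ : Form I),
      Disjoint G H ∧
      χ = ((Form.box G hG φ).and (Form.box H hH ψ)).imp
            (Form.box (G ∪ H) (unionNE hG) (φ.and ψ)) }

/-- Axiom schema B2: `□_{G∪H}⊤ → □_G⊤`. -/
def B2Ax (I : Type) [DecidableEq I] : Set (Form I) :=
  { χ | ∃ (G H : Finset I) (hG : G.Nonempty) (_hH : H.Nonempty),
      χ = (Form.box (G ∪ H) (unionNE hG) Form.top).imp (Form.box G hG Form.top) }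

/-- Axiom schema B3: `(□_Gφ ∧ □_{G∪H∪J}φ) → □_{G∪H}φ`. -/
def B3Ax (I : Type) [DecidableEq I] : Set (Form I) :=
  { χ | ∃ (G H J : Finset I) (hG : G.Nonempty) (_hH : H.Nonempty)
      (_hJ : J.Nonempty) (φ : Form I),
      χ = ((Form.box G hG φ).and (Form.box (G ∪ H ∪ J) (unionNE (unionNE hG)) φ)).imp
            (Form.box (G ∪ H) (unionNE hG) φ) }

/-- Axiom schema B4: `(□_Gφ ∧ □_H(φ∨ψ)) → □_{G∪H}φ`. -/
def B4Ax (I : Type) [DecidableEq I] : Set (Form I) :=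
  { χ | ∃ (G H : Finset I) (hG : G.Nonempty) (hH : H.Nonempty) (φ ψ : Form I),
      χ = ((Form.box G hG φ).and (Form.box H hH (φ.or ψ))).imp
            (Form.box (G ∪ H) (unionNE hG) φ) }

/-- The axioms of the base logic. -/
def BaseAx (I : Type) [DecidableEq I] : Set (Form I) :=
  B1Ax I ∪ B2Ax I ∪ B3Ax I ∪ B4Ax I

/-- Hilbert-style provability from classical tautologies and the axioms in
`Ax`, closed under modus ponens and replacement of equivalents. -/
inductive Prv {I : Type} (Ax : Set (Form I)) : Form I → Prop
  | taut {φ : Form I} : Tautology φ → Prv Ax φ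
  | ax {φ : Form I} : φ ∈ Ax → Prv Ax φ
  | mp {φ ψ : Form I} : Prv Ax (φ.imp ψ) → Prv Ax φ → Prv Ax ψ
  | re {φ ψ : Form I} (G : Finset I) (hG : G.Nonempty) :
      Prv Ax (φ.iff ψ) → Prv Ax ((Form.box G hG φ).iff (Form.box G hG ψ))

/-- `Γ ⊢ φ` iff there are `ψ₁,…,ψₙ ∈ Γ` with `⊢ (ψ₁∧…∧ψₙ) → φ`. -/
def Deduces {I : Type} (Ax : Set (Form I)) (Γ : Set (Form I)) (φ : Form I) :
    Prop :=
  ∃ l : List (Form I), (∀ ψ ∈ l, ψ ∈ Γ) ∧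
    Prv Ax ((l.foldr Form.and Form.top).imp φ)

/-- Semantic consequence over a class of models. -/
def SemConseq {I : Type} (C : NbhModel I → Prop) (Γ : Set (Form I))
    (φ : Form I) : Prop :=
  ∀ M : NbhModel I, C M → ∀ w : M.W, (∀ ψ ∈ Γ, M.sat w ψ) → M.sat w φ

/-- Soundness and strong completeness of `Ax` w.r.t. the class `C`. -/
def SoundComplete {I : Type} (Ax : Set (Form I)) (C : NbhModel I → Prop) :
    Prop :=
  ∀ (Γ : Set (Form I)) (φ : Form I), Deduces Ax Γ φ ↔ SemConseq C Γ φ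

/-- Axioms of the cheap extensions: for each i ∈ I, the selected axioms among
□_i⊤ (NEC), ¬□_i⊤ (CONEC), ¬□_i⊥ (P), □_i⊥ (COP). -/
def CheapAx (I : Type) [DecidableEq I] (nec conec pax cop : I → Prop) :
    Set (Form I) :=
  { χ | ∃ i : I,
      (nec i ∧ χ = Form.box {i} (Finset.singleton_nonempty i) Form.top) ∨
      (conec i ∧ χ = (Form.box {i} (Finset.singleton_nonempty i) Form.top).neg) ∨
      (pax i ∧ χ = (Form.box {i} (Finset.singleton_nonempty i) Form.bot).neg) ∨
      (cop i ∧ χ = Form.box {i} (Finset.singleton_nonempty i) Form.bot) }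

/-- The corresponding frame conditions. -/
def CheapFrame {I : Type} (nec conec pax cop : I → Prop) (M : NbhModel I) :
    Prop :=
  (∀ i : I, nec i → ∀ w : M.W, Set.univ ∈ M.N i w) ∧
  (∀ i : I, conec i → ∀ w : M.W, Set.univ ∉ M.N i w) ∧
  (∀ i : I, pax i → ∀ w : M.W, (∅ : Set M.W) ∉ M.N i w) ∧
  (∀ i : I, cop i → ∀ w : M.W, (∅ : Set M.W) ∈ M.N i w)

/-- The schema (P_G): ¬□_G⊥ for all finite nonempty G ⊆ I. -/
def PGAx (I : Type) [DecidableEq I] : Set (Form I) :=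
  { χ | ∃ (G : Finset I) (hG : G.Nonempty), χ = (Form.box G hG Form.bot).neg }

section Semantics

variable {I W : Type} (N : I → W → Set (Set W)) (V : ℕ → Set W)

theorem evalP_satN (w : W) (φ : Form I) :
    evalP (fun χ => satN N V χ w) φ ↔ satN N V φ w := by
  induction φ with
  | atom n => rfl
  | bot => rfl
  | neg φ ih => exact not_congr ih
  | or φ ψ ih₁ ih₂ => exact or_congr ih₁ ih₂
  | box G h φ => rfl

@[simp] theorem satN_and (w : W) (φ ψ : Form I) :
    satN N V (φ.and ψ) w ↔ satN N V φ w ∧ satN N V ψ w := by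
  simp [Form.and, satN]

@[simp] theorem satN_imp (w : W) (φ ψ : Form I) :
    satN N V (φ.imp ψ) w ↔ (satN N V φ w → satN N V ψ w) := by
  simp [Form.imp, satN, imp_iff_not_or]

@[simp] theorem satN_iff (w : W) (φ ψ : Form I) :
    satN N V (φ.iff ψ) w ↔ (satN N V φ w ↔ satN N V ψ w) := by
  simp [Form.iff, iff_iff_implies_and_implies]

@[simp] theorem satN_top (w : W) : satN N V (Form.top : Form I) w := by
  simp [Form.top, satN]

theorem satN_foldr_and (w : W) (l : List (Form I)) :
    satN N V (l.foldr Form.and Form.top) w ↔ ∀ ψ ∈ l, satN N V ψ w := by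
  induction l with
  | nil => simp
  | cons a l ih => simp [ih]

variable {N V}

theorem mem_ptwInter_singleton {i : I} {w : W} {X : Set W} :
    X ∈ ptwInter N {i} w ↔ X ∈ N i w := by
  constructor
  · rintro ⟨Y, hY, rfl⟩
    simpa using hY i (by simp)
  · intro h
    exact ⟨fun _ => X, by simpa using h, by simp⟩

theorem ptwInter_disjoint_union [DecidableEq I] {G H : Finset I} {w : W} {X Y : Set W}
    (hd : Disjoint G H) (hX : X ∈ ptwInter N G w) (hY : Y ∈ ptwInter N H w) :
    X ∩ Y ∈ ptwInter N (G ∪ H) w := by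
  obtain ⟨A, hA, rfl⟩ := hX
  obtain ⟨B, hB, rfl⟩ := hY
  have hG : ∀ i ∈ H, i ∉ G := fun i hi hi' => Finset.disjoint_left.1 hd hi' hi
  refine ⟨fun i => if i ∈ G then A i else B i, fun i hi => ?_, ?_⟩
  · by_cases h : i ∈ G
    · simpa [h] using hA i h
    · simpa [h] using hB i ((Finset.mem_union.1 hi).resolve_left h)
  · ext x
    simp only [Set.mem_inter_iff, Set.mem_iInter, Finset.mem_union]
    constructor
    · rintro ⟨h₁, h₂⟩ i hi
      by_cases h : i ∈ G
      · simpa [h] using h₁ i h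
      · simpa [h] using h₂ i (hi.resolve_left h)
    · intro h
      exact ⟨fun i hi => by simpa [hi] using h i (Or.inl hi),
        fun i hi => by simpa [hG i hi] using h i (Or.inr hi)⟩

theorem univ_mem_ptwInter_mono {G H : Finset I} {w : W} (hGH : G ⊆ H)
    (h : Set.univ ∈ ptwInter N H w) : Set.univ ∈ ptwInter N G w := by
  obtain ⟨A, hA, h⟩ := h
  refine ⟨A, fun i hi => hA i (hGH hi), ?_⟩
  exact (Set.univ_subset_iff.1 (h.subset.trans (Set.biInter_subset_biInter_left hGH))).symm

theorem ptwInter_extend [DecidableEq I] {G H K : Finset I} {w : W} {X Y : Set W}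
    (hGH : G ⊆ H) (hK : H ⊆ G ∪ K) (hXY : X ⊆ Y)
    (hX : X ∈ ptwInter N G w) (hY : Y ∈ ptwInter N K w) :
    X ∈ ptwInter N H w := by
  obtain ⟨A, hA, rfl⟩ := hX
  obtain ⟨B, hB, rfl⟩ := hY
  refine ⟨fun i => if i ∈ G then A i else B i, fun i hi => ?_, ?_⟩
  · by_cases h : i ∈ G
    · simpa [h] using hA i h
    · simpa [h] using hB i ((Finset.mem_union.1 (hK hi)).resolve_left h)
  · apply Set.Subset.antisymm
    · intro x hx
      have hx' := Set.mem_iInter₂.1 (hXY hx)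
      refine Set.mem_iInter₂.2 fun i hi => ?_
      by_cases h : i ∈ G
      · simpa [h] using Set.mem_iInter₂.1 hx i h
      · simpa [h] using hx' i ((Finset.mem_union.1 (hK hi)).resolve_left h)
    · intro x hx
      refine Set.mem_iInter₂.2 fun i hi => ?_
      simpa [hi] using Set.mem_iInter₂.1 hx i (hGH hi)

theorem satN_baseAx [DecidableEq I] {χ : Form I} (h : χ ∈ BaseAx I) (w : W) :
    satN N V χ w := by
  rcases h with ((⟨G, H, hG, hH, φ, ψ, hd, rfl⟩ | ⟨G, H, hG, hH, rfl⟩) |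
    ⟨G, H, J, hG, hH, hJ, φ, rfl⟩) | ⟨G, H, hG, hH, φ, ψ, rfl⟩
  · simp only [satN_imp, satN_and, satN]
    exact fun h => ptwInter_disjoint_union hd h.1 h.2
  · simp only [satN_imp, satN, satN_top, Set.ofPred_true]
    exact univ_mem_ptwInter_mono Finset.subset_union_left
  · simp only [satN_imp, satN_and, satN]
    exact fun h => ptwInter_extend Finset.subset_union_left
      (Finset.subset_union_left.trans Finset.subset_union_right) subset_rfl h.1 h.2
  · simp only [satN_imp, satN_and, satN]
    exact fun h => ptwInter_extend Finset.subset_union_left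
      (fun i hi => by simpa using hi) (fun _ => Or.inl) h.1 h.2

theorem satN_of_prv {Ax : Set (Form I)} (hAx : ∀ χ ∈ Ax, ∀ w, satN N V χ w)
    {φ : Form I} (h : Prv Ax φ) (w : W) : satN N V φ w := by
  induction h generalizing w with
  | taut h => exact (evalP_satN N V w _).1 (h _)
  | ax h => exact hAx _ h w
  | mp _ _ ih₁ ih₂ => exact (satN_imp N V w _ _).1 (ih₁ w) (ih₂ w)
  | re G hG _ ih =>
    simp only [satN_iff] at ih ⊢
    simp only [satN, ih]

end Semantics

section Valuations

variable {I : Type}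

@[simp] theorem evalP_neg (v : Form I → Prop) (φ : Form I) :
    evalP v φ.neg ↔ ¬ evalP v φ := Iff.rfl

@[simp] theorem evalP_or (v : Form I → Prop) (φ ψ : Form I) :
    evalP v (φ.or ψ) ↔ evalP v φ ∨ evalP v ψ := Iff.rfl

@[simp] theorem evalP_bot (v : Form I → Prop) : ¬ evalP v Form.bot := id

@[simp] theorem evalP_and (v : Form I → Prop) (φ ψ : Form I) :
    evalP v (φ.and ψ) ↔ evalP v φ ∧ evalP v ψ := by
  simp [Form.and]

@[simp] theorem evalP_imp (v : Form I → Prop) (φ ψ : Form I) :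
    evalP v (φ.imp ψ) ↔ (evalP v φ → evalP v ψ) := by
  simp [Form.imp, imp_iff_not_or]

@[simp] theorem evalP_iff (v : Form I → Prop) (φ ψ : Form I) :
    evalP v (φ.iff ψ) ↔ (evalP v φ ↔ evalP v ψ) := by
  simp [Form.iff, iff_iff_implies_and_implies]

@[simp] theorem evalP_top (v : Form I → Prop) : evalP v Form.top := by
  simp [Form.top]

theorem evalP_foldr_and (v : Form I → Prop) (l : List (Form I)) :
    evalP v (l.foldr Form.and Form.top) ↔ ∀ ψ ∈ l, evalP v ψ := by
  induction l with
  | nil => simp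
  | cons a l ih => simp [ih]

theorem isClopen_evalP (φ : Form I) :
    IsClopen {v : Form I → Bool | evalP (fun χ => v χ = true) φ} := by
  have key (χ : Form I) : IsClopen {v : Form I → Bool | v χ = true} :=
    (isClopen_discrete {true}).preimage (continuous_apply χ)
  induction φ with
  | atom n => exact key _
  | bot => exact isClopen_empty
  | neg φ ih => exact ih.compl
  | or φ ψ ih₁ ih₂ => exact ih₁.union ih₂
  | box G h φ => exact key _

/-- Compactness of propositional logic. -/
theorem exists_evalP_of_finite (T : Set (Form I))
    (h : ∀ s : Finset (Form I), ↑s ⊆ T → ∃ v : Form I → Prop, ∀ φ ∈ s, evalP v φ) :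
    ∃ v : Form I → Prop, ∀ φ ∈ T, evalP v φ := by
  obtain ⟨v, hv⟩ := CompactSpace.iInter_nonempty
    (t := fun φ : T => {v : Form I → Bool | evalP (fun χ => v χ = true) φ})
    (fun φ => (isClopen_evalP (φ : Form I)).isClosed) fun s => by
      obtain ⟨v, hv⟩ := h (s.map (Function.Embedding.subtype _)) (by simp)
      refine ⟨fun χ => decide (v χ), ?_⟩
      simp only [Set.mem_iInter, Set.mem_ofPred_eq, decide_eq_true_eq]
      exact fun φ hφ => hv φ (Finset.mem_map_of_mem _ hφ)
  exact ⟨_, fun φ hφ => Set.mem_iInter.1 hv ⟨φ, hφ⟩⟩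

/-- Valuations verifying every theorem; these play the role of maximal consistent sets. -/
def TheoryVal (Ax : Set (Form I)) : Type :=
  {v : Form I → Prop // ∀ χ, Prv Ax χ → evalP v χ}

theorem Prv.of_list {Ax : Set (Form I)} {φ : Form I} (l : List (Form I))
    (hl : ∀ ψ ∈ l, Prv Ax ψ) (h : ∀ v, (∀ ψ ∈ l, evalP v ψ) → evalP v φ) : Prv Ax φ := by
  induction l generalizing φ with
  | nil => exact .taut fun v => h v (by simp)
  | cons a l ih =>
    refine .mp (ih (φ := a.imp φ) (fun ψ hψ => hl ψ (by simp [hψ])) fun v hv => ?_)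
      (hl a (by simp))
    rw [evalP_imp]
    exact fun ha => h v (by simpa [ha] using hv)

theorem deduces_of_forall_theoryVal {Ax Γ : Set (Form I)} {φ : Form I}
    (h : ∀ v : TheoryVal Ax, (∀ ψ ∈ Γ, evalP v.1 ψ) → evalP v.1 φ) : Deduces Ax Γ φ := by
  by_contra hn
  obtain ⟨v, hv⟩ := exists_evalP_of_finite ({χ | Prv Ax χ} ∪ Γ ∪ {φ.neg}) fun s hs => by
    by_contra! hc
    refine hn ⟨(s.filter (· ∈ Γ)).toList, by simp, ?_⟩
    refine Prv.of_list (s.filter (Prv Ax ·)).toList (by simp) fun v hv => ?_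
    rw [evalP_imp, evalP_foldr_and]
    intro hΓ
    by_contra hφ
    obtain ⟨ψ, hψ, hψv⟩ := hc v
    rcases hs hψ with (h₁ | h₁) | h₁
    · exact hψv (hv ψ (by simpa using ⟨hψ, h₁⟩))
    · exact hψv (hΓ ψ (by simpa using ⟨hψ, h₁⟩))
    · exact hψv (h₁ ▸ hφ)
  exact hv φ.neg (by simp)
    (h ⟨v, fun χ hχ => hv χ (Or.inl (Or.inl hχ))⟩ fun ψ hψ => hv ψ (Or.inl (Or.inr hψ)))

theorem prv_of_forall_theoryVal {Ax : Set (Form I)} {φ : Form I}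
    (h : ∀ v : TheoryVal Ax, evalP v.1 φ) : Prv Ax φ := by
  obtain ⟨l, hl, hp⟩ := deduces_of_forall_theoryVal (Γ := ∅) fun v _ => h v
  obtain rfl : l = [] := List.eq_nil_iff_forall_not_mem.2 hl
  exact .mp hp (.taut fun v => evalP_top v)

end Valuations

section Separation

variable {I Θ : Type}

/-- The closure conditions on coalitional neighbourhoods corresponding to (B1)–(B4). -/
structure IsCoalitional [DecidableEq I] (ν : Finset I → Set Θ → Prop) : Prop where
  inter {G H A B} : Disjoint G H → ν G A → ν H B → ν (G ∪ H) (A ∩ B)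
  univ_mono {G H} : G ⊆ H → G.Nonempty → ν H Set.univ → ν G Set.univ
  convex {G H K A} : G ⊆ H → H ⊆ K → ν G A → ν K A → ν H A
  union {G H A B} : A ⊆ B → ν G A → ν H B → ν (G ∪ H) A

variable (I Θ) in
/-- Functions choosing a member of every labelled nonempty coalition. -/
def Selector : Type :=
  ∀ K : Finset I, K.Nonempty → Set Θ → {i // i ∈ K}

/-- The contribution of `i` to the joint neighbourhood `A` of the coalition `K`. -/
def piece (i : I) (K : Finset I) (A : Set Θ) : Set (Θ × Selector I Θ) :=
  {x | ∀ hK : K.Nonempty, (x.2 K hK A : I) = i → x.1 ∈ A}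

/-- The individual neighbourhoods generated by `ν`. -/
def pieces (ν : Finset I → Set Θ → Prop) (i : I) : Set (Set (Θ × Selector I Θ)) :=
  {X | ∃ K A, i ∈ K ∧ ν K A ∧ X = piece i K A}

theorem exists_selector (R : Finset I → Set Θ → I → Prop) :
    ∃ f : Selector I Θ, ∀ K hK A, (∃ i ∈ K, R K A i) → R K A (f K hK A) := by
  have (K : Finset I) (hK : K.Nonempty) (A : Set Θ) :
      ∃ i : {i // i ∈ K}, (∃ i ∈ K, R K A i) → R K A i := by
    by_cases h : ∃ i ∈ K, R K A i
    · obtain ⟨i, hi, hR⟩ := h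
      exact ⟨⟨i, hi⟩, fun _ => hR⟩
    · exact ⟨⟨_, hK.choose_spec⟩, fun h' => absurd h' h⟩
  choose f hf using this
  exact ⟨f, hf⟩

variable [DecidableEq I] {ν : Finset I → Set Θ → Prop}

theorem IsCoalitional.biInter (hν : IsCoalitional ν) (Q : Finset (Finset I × Set Θ))
    (hQ : Q.Nonempty) (hmem : ∀ p ∈ Q, ν p.1 p.2)
    (hd : ∀ p ∈ Q, ∀ q ∈ Q, p ≠ q → Disjoint p.1 q.1) :
    ν (Q.biUnion Prod.fst) (⋂ p ∈ Q, p.2) := by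
  induction hQ using Finset.Nonempty.cons_induction with
  | singleton p => simpa using hmem
  | cons p Q hp hQ ih =>
    simp only [Finset.cons_eq_insert, Finset.biUnion_insert, Finset.mem_insert,
      Set.iInter_iInter_eq_or_left] at *
    refine hν.inter ?_ (hmem p (Or.inl rfl)) (ih (fun q hq => hmem q (Or.inr hq))
      fun q hq r hr => hd q (Or.inr hq) r (Or.inr hr))
    rw [Finset.disjoint_biUnion_right]
    exact fun q hq => hd p (Or.inl rfl) q (Or.inr hq) (by rintro rfl; exact hp hq)

theorem IsCoalitional.union_biUnion (hν : IsCoalitional ν) {H : Finset I} {B : Set Θ}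
    (hH : ν H B) (K : I → Finset I) (A : I → Set Θ) (G : Finset I)
    (hG : ∀ i ∈ G, ν (K i) (A i) ∧ B ⊆ A i) : ν (H ∪ G.biUnion K) B := by
  induction G using Finset.induction_on with
  | empty => simpa using hH
  | insert i G _ ih =>
    have h := hν.union (hG i (by simp)).2
      (ih fun j hj => hG j (Finset.mem_insert_of_mem hj)) (hG i (by simp)).1
    rwa [Finset.biUnion_insert, Finset.union_comm (K i), ← Finset.union_assoc]

theorem IsCoalitional.univ_of_singletons (hν : IsCoalitional ν) {G : Finset I}
    (hne : G.Nonempty) (hG : ∀ i ∈ G, ν {i} Set.univ) : ν G Set.univ := by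
  induction hne using Finset.Nonempty.cons_induction with
  | singleton i => simpa using hG
  | cons i G hi _ ih =>
    have h := hν.inter (Finset.disjoint_singleton_left.2 hi) (hG i (by simp))
      (ih fun j hj => hG j (by simp [hj]))
    rwa [Set.univ_inter, ← Finset.insert_eq, ← Finset.cons_eq_insert i G hi] at h

theorem IsCoalitional.mem_of_iInter_pieces (hν : IsCoalitional ν) {G : Finset I}
    (hne : G.Nonempty) (K : I → Finset I) (A : I → Set Θ) {B : Set Θ}
    (hK : ∀ i ∈ G, i ∈ K i) (hA : ∀ i ∈ G, ν (K i) (A i))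
    (hB : ∀ x : Θ × Selector I Θ, x.1 ∈ B ↔ ∀ i ∈ G, x ∈ piece i (K i) (A i)) :
    ν G B := by
  have hBA : ∀ i ∈ G, B ⊆ A i := fun i hi t ht => by
    obtain ⟨f, hf⟩ := exists_selector (Θ := Θ) fun _ _ j => j = i
    exact (hB (t, f)).1 ht i hi ⟨i, hK i hi⟩ (hf _ _ _ ⟨i, hK i hi, rfl⟩)
  let Used (p : Finset I × Set Θ) (i : I) : Prop := i ∈ G ∧ K i = p.1 ∧ A i = p.2
  let Q := (G.image fun i => (K i, A i)).filter fun p => ∀ i ∈ p.1, Used p i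
  have hQ_used : ∀ p ∈ Q, ∀ i ∈ p.1, Used p i := fun p hp => (Finset.mem_filter.1 hp).2
  have hQ_lab : ∀ p ∈ Q, ∃ i ∈ G, (K i, A i) = p := fun p hp =>
    Finset.mem_image.1 (Finset.mem_filter.1 hp).1
  have hBQ : B = ⋂ p ∈ Q, p.2 := by
    apply Set.Subset.antisymm
    · refine Set.subset_iInter₂ fun p hp => ?_
      obtain ⟨i, hi, rfl⟩ := hQ_lab p hp
      exact hBA i hi
    · intro t ht
      rw [Set.mem_iInter₂] at ht
      obtain ⟨f, hf⟩ := exists_selector (Θ := Θ) fun L C j => ¬ Used (L, C) j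
      refine (hB (t, f)).2 fun i hi hne h => ?_
      by_cases hfull : ∀ j ∈ K i, Used (K i, A i) j
      · exact ht (K i, A i) (Finset.mem_filter.2 ⟨Finset.mem_image_of_mem _ hi, hfull⟩)
      · push Not at hfull
        have hnot := hf (K i) hne (A i) hfull
        rw [show (f (K i) hne (A i) : I) = i from h] at hnot
        exact absurd ⟨hi, rfl, rfl⟩ hnot
  rcases Q.eq_empty_or_nonempty with hQ | hQ
  · obtain rfl : B = Set.univ := by simpa [hQ] using hBQ
    refine hν.univ_of_singletons hne fun i hi => ?_
    refine hν.univ_mono (Finset.singleton_subset_iff.2 (hK i hi))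
      (Finset.singleton_nonempty i) ?_
    rw [← Set.univ_subset_iff.1 (hBA i hi)]
    exact hA i hi
  · have hH : ν (Q.biUnion Prod.fst) B := by
      rw [hBQ]
      refine hν.biInter Q hQ (fun p hp => ?_) fun p hp q hq hpq => ?_
      · obtain ⟨i, hi, rfl⟩ := hQ_lab p hp
        exact hA i hi
      · refine Finset.disjoint_left.2 fun i hip hiq => hpq ?_
        obtain ⟨-, h₁, h₂⟩ := hQ_used p hp i hip
        obtain ⟨-, h₃, h₄⟩ := hQ_used q hq i hiq
        exact Prod.ext (h₁.symm.trans h₃) (h₂.symm.trans h₄)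
    refine hν.convex (Finset.biUnion_subset.2 fun p hp i hi => (hQ_used p hp i hi).1) ?_ hH
      (hν.union_biUnion hH K A G fun i hi => ⟨hA i hi, hBA i hi⟩)
    exact fun i hi => Finset.mem_union_right _ (Finset.mem_biUnion.2 ⟨i, hi, hK i hi⟩)

theorem mem_ptwInter_pieces {μ : Θ → Finset I → Set Θ → Prop} {w : Θ × Selector I Θ}
    (hμ : IsCoalitional (μ w.1)) {G : Finset I} (hG : G.Nonempty) {B : Set Θ} :
    {x | x.1 ∈ B} ∈ ptwInter (fun i w => pieces (μ w.1) i) G w ↔ μ w.1 G B := by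
  constructor
  · rintro ⟨Y, hY, hB⟩
    choose! K A hK hA hYp using hY
    refine hμ.mem_of_iInter_pieces hG K A hK hA fun x => ?_
    have := Set.ext_iff.1 hB x
    rw [Set.mem_iInter₂] at this
    exact this.trans (forall₂_congr fun i hi => by rw [hYp i hi])
  · intro h
    refine ⟨fun i => piece i G B, fun i hi => ⟨G, B, hi, h, rfl⟩, ?_⟩
    ext x
    rw [Set.mem_iInter₂]
    exact ⟨fun hx _ _ _ _ => hx, fun hx => hx _ (x.2 G hG B).2 hG rfl⟩

end Separation

section Canonical

variable {I : Type} {Ax : Set (Form I)}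

/-- The valuations in `TheoryVal Ax` verifying `φ`. -/
def truthSet (Ax : Set (Form I)) (φ : Form I) : Set (TheoryVal Ax) :=
  {v | evalP v.1 φ}

/-- The sets that `v` declares to be joint neighbourhoods of the coalition `G`. -/
def boxed (v : TheoryVal Ax) (G : Finset I) (A : Set (TheoryVal Ax)) : Prop :=
  ∃ (h : G.Nonempty) (φ : Form I), A = truthSet Ax φ ∧ evalP v.1 (.box G h φ)

theorem box_congr (v : TheoryVal Ax) {G : Finset I} {h : G.Nonempty} {φ ψ : Form I}
    (hφψ : truthSet Ax φ = truthSet Ax ψ) :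
    evalP v.1 (.box G h φ) ↔ evalP v.1 (.box G h ψ) := by
  have := v.2 _ (Prv.re G h (prv_of_forall_theoryVal (φ := φ.iff ψ) fun u => by
    rw [evalP_iff]
    exact Set.ext_iff.1 hφψ u))
  rwa [evalP_iff] at this

theorem boxed_truthSet {v : TheoryVal Ax} {G : Finset I} (h : G.Nonempty) {φ : Form I} :
    boxed v G (truthSet Ax φ) ↔ evalP v.1 (.box G h φ) :=
  ⟨fun ⟨_, _, hψ, hv⟩ => (box_congr v hψ).2 hv, fun hv => ⟨h, φ, rfl, hv⟩⟩

theorem truthSet_top : truthSet Ax Form.top = Set.univ :=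
  Set.eq_univ_of_forall fun v => evalP_top v.1

theorem truthSet_bot : truthSet Ax Form.bot = ∅ := rfl

theorem boxed_isCoalitional [DecidableEq I] (hAx : BaseAx I ⊆ Ax) (v : TheoryVal Ax) :
    IsCoalitional (boxed v) where
  inter := by
    rintro G H _ _ hd ⟨hG, φ, rfl, hφ⟩ ⟨hH, ψ, rfl, hψ⟩
    have hb := v.2 _ (.ax (hAx (Or.inl (Or.inl (Or.inl ⟨G, H, hG, hH, φ, ψ, hd, rfl⟩)))))
    rw [evalP_imp, evalP_and] at hb
    exact ⟨_, φ.and ψ, Set.ext fun u => (evalP_and u.1 φ ψ).symm, hb ⟨hφ, hψ⟩⟩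
  univ_mono := by
    intro G H hGH hG h
    rw [← truthSet_top, boxed_truthSet (hG.mono hGH)] at h
    rw [← truthSet_top, boxed_truthSet hG]
    have hb := v.2 _ (.ax (hAx (Or.inl (Or.inl (Or.inr ⟨G, H, hG, hG.mono hGH, rfl⟩)))))
    simp only [Finset.union_eq_right.2 hGH] at hb
    rw [evalP_imp] at hb
    exact hb h
  convex := by
    rintro G H K _ hGH hHK ⟨hG, φ, rfl, hφ⟩ h
    have hH := hG.mono hGH
    rw [boxed_truthSet (hH.mono hHK)] at h
    rw [boxed_truthSet hH]
    have hb := v.2 _ (.ax (hAx (Or.inl (Or.inr ⟨G, H, K, hG, hH, hH.mono hHK, φ, rfl⟩))))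
    simp only [Finset.union_eq_right.2 hGH, Finset.union_eq_right.2 hHK] at hb
    rw [evalP_imp, evalP_and] at hb
    exact hb ⟨hφ, h⟩
  union := by
    rintro G H _ _ hAB ⟨hG, φ, rfl, hφ⟩ ⟨hH, ψ, rfl, hψ⟩
    have hb := v.2 _ (.ax (hAx (Or.inr ⟨G, H, hG, hH, φ, ψ, rfl⟩)))
    rw [evalP_imp, evalP_and] at hb
    refine ⟨_, φ, rfl, hb ⟨hφ, (box_congr v (Set.ext fun u => ?_)).1 hψ⟩⟩
    exact ⟨Or.inr, fun h => h.elim (fun h' => hAB h') id⟩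

/-- The individual neighbourhoods of the canonical model. -/
def canonicalN (Ax : Set (Form I)) (i : I) (w : TheoryVal Ax × Selector I (TheoryVal Ax)) :
    Set (Set (TheoryVal Ax × Selector I (TheoryVal Ax))) :=
  pieces (boxed w.1) i

theorem mem_ptwInter_canonicalN [DecidableEq I] (hAx : BaseAx I ⊆ Ax)
    (w : TheoryVal Ax × Selector I (TheoryVal Ax)) {G : Finset I} (hG : G.Nonempty)
    (φ : Form I) :
    {x | x.1 ∈ truthSet Ax φ} ∈ ptwInter (canonicalN Ax) G w ↔
      evalP w.1.1 (.box G hG φ) :=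
  (mem_ptwInter_pieces (μ := boxed) (boxed_isCoalitional hAx w.1) hG).trans (boxed_truthSet hG)

theorem univ_mem_canonicalN [DecidableEq I] (hAx : BaseAx I ⊆ Ax)
    (w : TheoryVal Ax × Selector I (TheoryVal Ax)) (i : I) :
    Set.univ ∈ canonicalN Ax i w ↔
      evalP w.1.1 (.box {i} (Finset.singleton_nonempty i) Form.top) := by
  rw [← mem_ptwInter_canonicalN hAx, mem_ptwInter_singleton, truthSet_top]
  rfl

theorem empty_mem_ptwInter_canonicalN [DecidableEq I] (hAx : BaseAx I ⊆ Ax)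
    (w : TheoryVal Ax × Selector I (TheoryVal Ax)) {G : Finset I} (hG : G.Nonempty) :
    ∅ ∈ ptwInter (canonicalN Ax) G w ↔ evalP w.1.1 (.box G hG Form.bot) := by
  rw [← mem_ptwInter_canonicalN hAx, truthSet_bot]
  rfl

theorem empty_mem_canonicalN [DecidableEq I] (hAx : BaseAx I ⊆ Ax)
    (w : TheoryVal Ax × Selector I (TheoryVal Ax)) (i : I) :
    ∅ ∈ canonicalN Ax i w ↔
      evalP w.1.1 (.box {i} (Finset.singleton_nonempty i) Form.bot) := by
  rw [← empty_mem_ptwInter_canonicalN hAx, mem_ptwInter_singleton]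

/-- The canonical valuation. -/
def canonicalV (Ax : Set (Form I)) (n : ℕ) :
    Set (TheoryVal Ax × Selector I (TheoryVal Ax)) :=
  {x | evalP x.1.1 (.atom n)}

theorem truth_lemma [DecidableEq I] (hAx : BaseAx I ⊆ Ax) (φ : Form I)
    (w : TheoryVal Ax × Selector I (TheoryVal Ax)) :
    satN (canonicalN Ax) (canonicalV Ax) φ w ↔ evalP w.1.1 φ := by
  induction φ generalizing w with
  | atom n => rfl
  | bot => rfl
  | neg φ ih => exact not_congr (ih w)
  | or φ ψ ih₁ ih₂ => exact or_congr (ih₁ w) (ih₂ w)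
  | box G hG φ ih =>
    rw [← mem_ptwInter_canonicalN hAx w hG φ]
    simp only [satN, ih]
    rfl

end Canonical

/-- The base logic plus any selection of the cheap axioms plus
all instances of (P_G) ¬□_G⊥ is sound and strongly complete w.r.t. the class
of models satisfying the corresponding frame conditions together with
∅ ∉ N_G(w) for every world w and every finite nonempty G ⊆ I. -/
theorem cheap_PG_sound_complete (I : Type) [DecidableEq I]
    (nec conec pax cop : I → Prop) :
    SoundComplete (BaseAx I ∪ CheapAx I nec conec pax cop ∪ PGAx I)
      (fun M : NbhModel I => CheapFrame nec conec pax cop M ∧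
        ∀ (G : Finset I), G.Nonempty → ∀ w : M.W,
          (∅ : Set M.W) ∉ ptwInter M.N G w) := by
  set Ax := BaseAx I ∪ CheapAx I nec conec pax cop ∪ PGAx I
  have hAx : BaseAx I ⊆ Ax := fun _ h => Or.inl (Or.inl h)
  intro Γ φ
  constructor
  · rintro ⟨l, hl, hp⟩ M ⟨⟨hnec, hconec, hpax, hcop⟩, hPG⟩ w hΓ
    have hvalid : ∀ χ ∈ Ax, ∀ w, satN M.N M.V χ w := by
      rintro χ ((h | ⟨i, ⟨hi, rfl⟩ | ⟨hi, rfl⟩ | ⟨hi, rfl⟩ | ⟨hi, rfl⟩⟩) | ⟨G, hG, rfl⟩) w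
      · exact satN_baseAx h w
      · simpa [satN, mem_ptwInter_singleton] using hnec i hi w
      · simpa [satN, mem_ptwInter_singleton] using hconec i hi w
      · simpa [satN, mem_ptwInter_singleton] using hpax i hi w
      · simpa [satN, mem_ptwInter_singleton] using hcop i hi w
      · simpa [satN] using hPG G hG w
    exact (satN_imp M.N M.V w _ _).1 (satN_of_prv hvalid hp w)
      ((satN_foldr_and M.N M.V w l).2 fun ψ hψ => hΓ ψ (hl ψ hψ))
  · intro h
    refine deduces_of_forall_theoryVal fun v hv => ?_
    let f : Selector I (TheoryVal Ax) := fun _ hK _ => ⟨hK.choose, hK.choose_spec⟩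
    refine (truth_lemma hAx φ (v, f)).1 (h ⟨_, ⟨(v, f)⟩, canonicalN Ax, canonicalV Ax⟩
      ⟨⟨fun i hi w => ?_, fun i hi w => ?_, fun i hi w => ?_, fun i hi w => ?_⟩,
        fun G hG w => ?_⟩ (v, f) fun ψ hψ => (truth_lemma hAx ψ (v, f)).2 (hv ψ hψ))
    · exact (univ_mem_canonicalN hAx w i).2
        (w.1.2 _ (.ax (Or.inl (Or.inr ⟨i, Or.inl ⟨hi, rfl⟩⟩))))
    · exact fun h => w.1.2 _ (.ax (Or.inl (Or.inr ⟨i, Or.inr (Or.inl ⟨hi, rfl⟩)⟩)))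
        ((univ_mem_canonicalN hAx w i).1 h)
    · exact fun h => w.1.2 _ (.ax (Or.inl (Or.inr ⟨i, Or.inr (Or.inr (Or.inl ⟨hi, rfl⟩))⟩)))
        ((empty_mem_canonicalN hAx w i).1 h)
    · exact (empty_mem_canonicalN hAx w i).2
        (w.1.2 _ (.ax (Or.inl (Or.inr ⟨i, Or.inr (Or.inr (Or.inr ⟨hi, rfl⟩))⟩))))
    · exact fun h => w.1.2 _ (.ax (Or.inr ⟨G, hG, rfl⟩))
        ((empty_mem_ptwInter_canonicalN hAx w hG).1 h)
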